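/- Let f ∈ Mould(m) and g ∈ Mould(n) both be vegetal, with nice poles, and homogeneous of weights −m and −n respectively. Then in ℚ(x) one has (f ∘ g)(x^{-1},…,x^{-1}) = (d/dx f(x^{-1},…,x^{-1})) · g(x^{-1},…,x^{-1}). In other words, the substitution u_i ↦ 1/x sends the pre-Lie product ∘ on such moulds to the usual pre-Lie product of formal vector fields, F(x)∂_x ∘ G(x)∂_x = F′(x)·G(x)·∂_x. -/

import Mathlib

/-!
Formalization of results from "The anticyclic operad of moulds" (F. Chapoton).

`Mould n` is the field of rational functions in variables `u 1, …, u n` with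
rational coefficients, realized as a subfield of the fraction field `K` of
`ℚ[X 0, X 1, X 2, …]`.  The variable `u 0 = X 0` is reserved as an auxiliary
variable (the parameter `t` or `λ`).  Substitution of rational functions for
the variables is realized by the (partial, well-defined) function `msub`.
-/

noncomputable section
namespace MouldOperad

open MvPolynomial Finset

attribute [local instance] Classical.propDecidable
set_option synthInstance.maxHeartbeats 1000000

abbrev MPoly : Type := MvPolynomial ℕ ℚ
abbrev K : Type := FractionRing MPoly

/-- the variable `u i` (1-based; index `0` is auxiliary). -/
def u (i : ℕ) : K := algebraMap MPoly K (X i)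

/-- `u_{i..j} = u_i + u_{i+1} + ⋯ + u_j`. -/
def usum (i j : ℕ) : K := ∑ k ∈ Finset.Icc i j, u k

/-- evaluation of polynomials, sending the variable `X k` to `v k`. -/
def pev (v : ℕ → K) : MPoly →+* K :=
  eval₂Hom ((algebraMap MPoly K).comp (C : ℚ →+* MPoly)) v

/-- Substitution of the rational functions `v k` for the variables of `f ∈ K`
(the induced field homomorphism): it takes the canonical value whenever `f` has
a fraction representation whose denominator does not vanish under the
substitution (this value does not depend on the representation), and the junk
value `0` otherwise. -/
def msub (v : ℕ → K) (f : K) : K :=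
  if h : ∃ w : K, ∃ p q : MPoly, q ≠ 0 ∧
      f = algebraMap MPoly K p / algebraMap MPoly K q ∧
      pev v q ≠ 0 ∧ w = pev v p / pev v q
  then h.choose else 0

/-- the field `Mould n` of rational functions in `u 1, …, u n`. -/
def Mould (n : ℕ) : Subfield K :=
  Subfield.closure {x : K | ∃ i, 1 ≤ i ∧ i ≤ n ∧ x = u i}

/-- substitution used for `f` in `f ∘_i g`, where `g` has degree `n`:
`f(u_1, …, u_{i-1}, u_{i..i+n-1}, u_{i+n}, …, u_{m+n-1})`. -/
def compSubF (n i : ℕ) : ℕ → K := fun k =>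
  if k < i then u k else if k = i then usum i (i + n - 1) else u (k + n - 1)

/-- substitution used for `g` in `f ∘_i g` : `g(u_i, …, u_{i+n-1})`. -/
def compSubG (i : ℕ) : ℕ → K := fun k => u (k + i - 1)

/-- the composition `f ∘_i g`, where `g` has degree `n` (1-based index `i`). -/
def comp (n i : ℕ) (f g : K) : K :=
  usum i (i + n - 1) * msub (compSubF n i) f * msub (compSubG i) g

/-- the push `τ` on `Mould n`: `τ(f)(u_1,…,u_n) = f(-u_{1..n}, u_1, …, u_{n-1})`. -/
def push (n : ℕ) (f : K) : K :=
  msub (fun k => if k = 1 then -(usum 1 n) else if k ≤ n then u (k - 1) else u k) f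

/-- a permutation of `Fin n` as a (1-based) permutation of `ℕ`. -/
def permExt (n : ℕ) (σ : Equiv.Perm (Fin n)) : ℕ → ℕ := fun k =>
  if h : 1 ≤ k ∧ k ≤ n then ((σ ⟨k - 1, by omega⟩ : Fin n) : ℕ) + 1 else k

/-- `f ∈ Mould n` is alternal : for each `1 ≤ i ≤ n-1`, the sum of
`f(u_{σ(1)}, …, u_{σ(n)})` over the shuffles `σ ∈ Sh(i, n-i)` vanishes. -/
def IsAlternal (n : ℕ) (f : K) : Prop :=
  ∀ i : ℕ, 1 ≤ i → i ≤ n - 1 →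
    ∑ σ ∈ Finset.univ.filter (fun σ : Equiv.Perm (Fin n) =>
        (∀ a b : Fin n, a < b → (b : ℕ) < i → σ a < σ b) ∧
        (∀ a b : Fin n, a < b → i ≤ (a : ℕ) → σ a < σ b)),
      msub (fun k => u (permExt n σ k)) f = 0

/-- `f ∈ Mould n` is vegetal :
`u_1⋯u_n · Σ_{σ ∈ S_n} f(t·u_{σ(1)}, …, t·u_{σ(n)}) = n! · f(t,…,t)`,
where the auxiliary variable `t` is `u 0`. -/
def IsVegetal (n : ℕ) (f : K) : Prop :=
  (∏ k ∈ Finset.Icc 1 n, u k) *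
      ∑ σ : Equiv.Perm (Fin n), msub (fun k => u 0 * u (permExt n σ k)) f =
    (n.factorial : K) * msub (fun _ => u 0) f

/-- `f ∈ Mould n` is homogeneous of weight `d` : `f(λu_1,…,λu_n) = λ^d·f`,
where the auxiliary variable `λ` is `u 0`. -/
def IsHomogeneousOfWeight (n : ℕ) (d : ℤ) (f : K) : Prop :=
  msub (fun k => if 1 ≤ k ∧ k ≤ n then u 0 * u k else u k) f = u 0 ^ d * f

/-- shift substitution : `g(u_{m+1}, …, u_{m+n})`. -/
def shiftSub (m : ℕ) : ℕ → K := fun k => u (k + m)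

/-- `f ≻ g` for `f ∈ Mould m`, `g ∈ Mould n`. -/
def dsucc (m n : ℕ) (f g : K) : K :=
  f * msub (shiftSub m) g * usum (m + 1) (m + n) / usum 1 (m + n)

/-- `f ≺ g` for `f ∈ Mould m`, `g ∈ Mould n`. -/
def dprec (m n : ℕ) (f g : K) : K :=
  f * msub (shiftSub m) g * usum 1 m / usum 1 (m + n)

/-- `MU(f,g)` for `f ∈ Mould m`. -/
def MU (m : ℕ) (f g : K) : K := f * msub (shiftSub m) g

/-- `LIMU(f,g) = MU(f,g) - MU(g,f)` for `f ∈ Mould m`, `g ∈ Mould n`. -/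
def LIMU (m n : ℕ) (f g : K) : K := MU m f g - MU n g f

/-- the pre-Lie product `f ↶ g` for `f ∈ Mould m`, `g ∈ Mould n`. -/
def preLieCurve (m n : ℕ) (f g : K) : K :=
  f * msub (shiftSub m) g * usum (m + 1) (m + n) / usum 1 (m + n)
    - g * msub (shiftSub n) f * usum 1 n / usum 1 (m + n)

/-- the pre-Lie product `f ∘ g = Σ_{i=1}^m f ∘_i g`, `f ∈ Mould m`, `g ∈ Mould n`. -/
def preLieComp (m n : ℕ) (f g : K) : K := ∑ i ∈ Finset.Icc 1 m, comp n i f g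

/-- `H_n = ∏_{1 ≤ i ≤ j ≤ n} u_{i..j}`. -/
def Hprod (n : ℕ) : K := ∏ i ∈ Finset.Icc 1 n, ∏ j ∈ Finset.Icc i n, usum i j

/-- `x` is (the image of) a polynomial in `u_1, …, u_n`. -/
def IsPolyIn (n : ℕ) (x : K) : Prop :=
  ∃ p : MPoly, (∀ k ∈ p.vars, 1 ≤ k ∧ k ≤ n) ∧ x = algebraMap MPoly K p

/-- `f ∈ Mould n` has nice poles: it is a polynomial divided by a product of
powers of the linear forms `u_{i..j}`, `1 ≤ i ≤ j ≤ n`. -/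
def HasNicePoles (n : ℕ) (f : K) : Prop :=
  ∃ (P : MPoly) (e : ℕ → ℕ → ℕ),
    (∀ k ∈ P.vars, 1 ≤ k ∧ k ≤ n) ∧
    f = algebraMap MPoly K P /
        ∏ i ∈ Finset.Icc 1 n, ∏ j ∈ Finset.Icc i n, usum i j ^ e i j

/-- the Over product `f / Y`, `f ∈ Mould n`. -/
def overY (n : ℕ) (f : K) : K := f / usum 1 (n + 1)

/-- the Under product `Y \ f`, `f ∈ Mould n`. -/
def underY (n : ℕ) (f : K) : K := msub (fun k => u (k + 1)) f / usum 1 (n + 1)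

/-- `ARIT(f,g) = f ∘ (g/Y) - f ∘ (Y\g)` for `f ∈ Mould m`, `g ∈ Mould n`. -/
def ARIT (m n : ℕ) (f g : K) : K :=
  preLieComp m (n + 1) f (overY n g) - preLieComp m (n + 1) f (underY n g)

/-- `ARI(f,g) = ARIT(f,g) - ARIT(g,f) + LIMU(f,g)`, `f ∈ Mould m`, `g ∈ Mould n`. -/
def ARI (m n : ℕ) (f g : K) : K := ARIT m n f g - ARIT n m g f + LIMU m n f g

/-- evaluation of polynomials into `RatFunc K` (rational functions in `t` over `K`). -/
def pevR (v : ℕ → RatFunc K) : MPoly →+* RatFunc K :=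
  eval₂Hom ((RatFunc.C).comp ((algebraMap MPoly K).comp (C : ℚ →+* MPoly))) v

/-- substitution into `RatFunc K`. -/
def msubR (v : ℕ → RatFunc K) (f : K) : RatFunc K :=
  if h : ∃ w : RatFunc K, ∃ p q : MPoly, q ≠ 0 ∧
      f = algebraMap MPoly K p / algebraMap MPoly K q ∧
      pevR v q ≠ 0 ∧ w = pevR v p / pevR v q
  then h.choose else 0

/-- residue at `t = 0`: the coefficient of `t⁻¹` in the Laurent expansion at `0`. -/
def res (r : RatFunc K) : K := (↑r : LaurentSeries K).coeff (-1)

/-- the mould derivative `∂f` for `f ∈ Mould m`: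
`∂f(u_1,…,u_{m-1}) = Σ_{j=1}^m Res_{t=0} f(u_1,…,u_{j-1},t,u_j,…,u_{m-1})`,
where `f(u_1,…,u_{j-1},t,u_j,…,u_{m-1})` is viewed in `RatFunc K`. -/
def mderiv (m : ℕ) (f : K) : K :=
  ∑ j ∈ Finset.Icc 1 m,
    res (msubR (fun k =>
      if k < j then RatFunc.C (u k)
      else if k = j then RatFunc.X
      else RatFunc.C (u (k - 1))) f)

/-- evaluation of polynomials into `ℚ(x)`, sending every variable to `1/x`. -/
def pevX : MPoly →+* RatFunc ℚ :=
  eval₂Hom (RatFunc.C : ℚ →+* RatFunc ℚ) (fun _ => (RatFunc.X)⁻¹)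

/-- the substitution `u_i ↦ 1/x`, landing in `ℚ(x)`. -/
def evalx (f : K) : RatFunc ℚ :=
  if h : ∃ w : RatFunc ℚ, ∃ p q : MPoly, q ≠ 0 ∧
      f = algebraMap MPoly K p / algebraMap MPoly K q ∧
      pevX q ≠ 0 ∧ w = pevX p / pevX q
  then h.choose else 0

/-- the derivative `d/dx` on `ℚ(x)`. -/
def rfDeriv (r : RatFunc ℚ) : RatFunc ℚ :=
  (algebraMap (Polynomial ℚ) (RatFunc ℚ) (Polynomial.derivative r.num) *
      algebraMap (Polynomial ℚ) (RatFunc ℚ) r.denom -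
    algebraMap (Polynomial ℚ) (RatFunc ℚ) r.num *
      algebraMap (Polynomial ℚ) (RatFunc ℚ) (Polynomial.derivative r.denom)) /
    algebraMap (Polynomial ℚ) (RatFunc ℚ) r.denom ^ 2

/-- evaluation of polynomials in `ℚ(x)`, sending the variable `X k` to `w k`. -/
def ratEval (w : ℕ → RatFunc ℚ) : MPoly →+* RatFunc ℚ :=
  eval₂Hom (RatFunc.C : ℚ →+* RatFunc ℚ) w

/-- `f ∈ K` is regular at the point `w` of `ℚ(x)`, with value `y`. -/
def HasValueAt (w : ℕ → RatFunc ℚ) (f : K) (y : RatFunc ℚ) : Prop :=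
  ∃ p q : MPoly, ratEval w q ≠ 0 ∧
    f = algebraMap MPoly K p / algebraMap MPoly K q ∧ y = ratEval w p / ratEval w q

theorem map_div_map_eq {F : Type*} [Field F] (φ : MPoly →+* F) {p q p' q' : MPoly}
    (hq : φ q ≠ 0) (hq' : φ q' ≠ 0)
    (h : algebraMap MPoly K p / algebraMap MPoly K q =
      algebraMap MPoly K p' / algebraMap MPoly K q') :
    φ p / φ q = φ p' / φ q' := by
  have hinj := IsFractionRing.injective MPoly K
  have ne : ∀ {r : MPoly}, φ r ≠ 0 → algebraMap MPoly K r ≠ 0 := fun hr h0 =>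
    hr (by rw [(map_eq_zero_iff _ hinj).1 h0, map_zero])
  rw [div_eq_div_iff (ne hq) (ne hq'), ← map_mul, ← map_mul] at h
  rw [div_eq_div_iff hq hq', ← map_mul, ← map_mul, hinj h]

theorem msub_div (v : ℕ → K) {p q : MPoly} (hq : pev v q ≠ 0) :
    msub v (algebraMap MPoly K p / algebraMap MPoly K q) = pev v p / pev v q := by
  have h : ∃ w : K, ∃ p' q' : MPoly, q' ≠ 0 ∧
      algebraMap MPoly K p / algebraMap MPoly K q =
        algebraMap MPoly K p' / algebraMap MPoly K q' ∧
      pev v q' ≠ 0 ∧ w = pev v p' / pev v q' :=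
    ⟨_, p, q, fun h0 => hq (by rw [h0, map_zero]), rfl, hq, rfl⟩
  rw [msub, dif_pos h]
  obtain ⟨p', q', -, he, hq', hw⟩ := h.choose_spec
  rw [hw]
  exact (map_div_map_eq (pev v) hq hq' he).symm

namespace HasValueAt

variable {w : ℕ → RatFunc ℚ} {f g : K} {y z : RatFunc ℚ}

theorem unique (h : HasValueAt w f y) (h' : HasValueAt w f z) : y = z := by
  obtain ⟨p, q, hq, hf, rfl⟩ := h
  obtain ⟨p', q', hq', hf', rfl⟩ := h'
  exact map_div_map_eq _ hq hq' (hf.symm.trans hf')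

theorem of_poly (w : ℕ → RatFunc ℚ) (p : MPoly) :
    HasValueAt w (algebraMap MPoly K p) (ratEval w p) :=
  ⟨p, 1, by simp, by simp, by simp⟩

theorem of_u (w : ℕ → RatFunc ℚ) (k : ℕ) : HasValueAt w (u k) (w k) := by
  simpa [ratEval, u] using of_poly w (X k)

theorem natCast (w : ℕ → RatFunc ℚ) (k : ℕ) : HasValueAt w (k : K) (k : RatFunc ℚ) := by
  simpa using of_poly w (k : MPoly)

theorem algebraMap_ne_zero {q : MPoly} (hq : ratEval w q ≠ 0) : algebraMap MPoly K q ≠ 0 :=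
  fun h0 => hq (by
    rw [(map_eq_zero_iff _ (IsFractionRing.injective MPoly K)).1 h0, map_zero])

theorem add (hf : HasValueAt w f y) (hg : HasValueAt w g z) :
    HasValueAt w (f + g) (y + z) := by
  obtain ⟨p, q, hq, rfl, rfl⟩ := hf
  obtain ⟨p', q', hq', rfl, rfl⟩ := hg
  refine ⟨p * q' + q * p', q * q', by simp [hq, hq'], ?_, ?_⟩
  · rw [div_add_div _ _ (algebraMap_ne_zero hq) (algebraMap_ne_zero hq')]
    simp only [map_add, map_mul]
  · rw [div_add_div _ _ hq hq']
    simp only [map_add, map_mul]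

theorem mul (hf : HasValueAt w f y) (hg : HasValueAt w g z) :
    HasValueAt w (f * g) (y * z) := by
  obtain ⟨p, q, hq, rfl, rfl⟩ := hf
  obtain ⟨p', q', hq', rfl, rfl⟩ := hg
  refine ⟨p * p', q * q', by simp [hq, hq'], ?_, ?_⟩
  · rw [div_mul_div_comm]
    simp only [map_mul]
  · rw [div_mul_div_comm]
    simp only [map_mul]

theorem inv (hf : HasValueAt w f y) (hy : y ≠ 0) : HasValueAt w f⁻¹ y⁻¹ := by
  obtain ⟨p, q, hq, rfl, rfl⟩ := hf
  exact ⟨q, p, fun h0 => hy (by rw [h0, zero_div]), inv_div _ _, inv_div _ _⟩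

theorem div (hf : HasValueAt w f y) (hg : HasValueAt w g z) (hz : z ≠ 0) :
    HasValueAt w (f / g) (y / z) := by
  simpa only [div_eq_mul_inv] using hf.mul (hg.inv hz)

theorem pow (hf : HasValueAt w f y) (k : ℕ) : HasValueAt w (f ^ k) (y ^ k) := by
  induction k with
  | zero => simpa using natCast w 1
  | succ k ih => simpa only [pow_succ] using ih.mul hf

theorem sum {ι : Type*} (s : Finset ι) {F : ι → K} {Y : ι → RatFunc ℚ}
    (h : ∀ i ∈ s, HasValueAt w (F i) (Y i)) :
    HasValueAt w (∑ i ∈ s, F i) (∑ i ∈ s, Y i) := by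
  induction s using Finset.induction_on with
  | empty => simpa using natCast w 0
  | insert a s ha ih =>
    rw [Finset.sum_insert ha, Finset.sum_insert ha]
    exact (h a (mem_insert_self a s)).add (ih fun i hi => h i (mem_insert_of_mem hi))

theorem prod {ι : Type*} (s : Finset ι) {F : ι → K} {Y : ι → RatFunc ℚ}
    (h : ∀ i ∈ s, HasValueAt w (F i) (Y i)) :
    HasValueAt w (∏ i ∈ s, F i) (∏ i ∈ s, Y i) := by
  induction s using Finset.induction_on with
  | empty => simpa using natCast w 1
  | insert a s ha ih =>
    rw [Finset.prod_insert ha, Finset.prod_insert ha]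
    exact (h a (mem_insert_self a s)).mul (ih fun i hi => h i (mem_insert_of_mem hi))

theorem usum (w : ℕ → RatFunc ℚ) (i j : ℕ) :
    HasValueAt w (usum i j) (∑ k ∈ Finset.Icc i j, w k) :=
  sum _ fun k _ => of_u w k

theorem of_pev {v : ℕ → K} {a : ℕ → RatFunc ℚ} (h : ∀ k, HasValueAt w (v k) (a k))
    (p : MPoly) : HasValueAt w (pev v p) (ratEval a p) := by
  induction p using MvPolynomial.induction_on with
  | C c =>
    rw [show pev v (C c) = algebraMap MPoly K (C c) from eval₂Hom_C _ _ _,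
      show ratEval a (C c) = ratEval w (C c) by simp [ratEval]]
    exact of_poly w (C c)
  | add p q hp hq => simpa only [map_add] using hp.add hq
  | mul_X p k hp => simpa [pev, ratEval] using hp.mul (h k)

theorem msub {v : ℕ → K} {a : ℕ → RatFunc ℚ} (h : ∀ k, HasValueAt w (v k) (a k))
    (hf : HasValueAt a f y) : HasValueAt w (msub v f) y := by
  obtain ⟨p, q, hq, rfl, rfl⟩ := hf
  have hne : pev v q ≠ 0 := fun h0 => hq <| (of_pev h q).unique <| by
    simpa [h0] using natCast w 0
  rw [msub_div v hne]
  exact (of_pev h p).div (of_pev h q) hq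

theorem evalx_eq (hf : HasValueAt (fun _ => RatFunc.X⁻¹) f y) : evalx f = y := by
  obtain ⟨p, q, hq, hf, rfl⟩ := hf
  have h : ∃ w : RatFunc ℚ, ∃ p' q' : MPoly, q' ≠ 0 ∧
      f = algebraMap MPoly K p' / algebraMap MPoly K q' ∧
      pevX q' ≠ 0 ∧ w = pevX p' / pevX q' :=
    ⟨_, p, q, fun h0 => hq (by rw [h0, map_zero]), hf, hq, rfl⟩
  rw [evalx, dif_pos h]
  obtain ⟨p', q', -, he, hq', hw⟩ := h.choose_spec
  rw [hw]
  exact map_div_map_eq pevX hq' hq (he.symm.trans hf)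

end HasValueAt

/-- A mould with nice poles is regular at every point at which no linear form `u_{i..j}` vanishes,
and its value depends only on the coordinates `1, …, n`. -/
theorem HasNicePoles.exists_value {n : ℕ} {f : K} (hf : HasNicePoles n f) :
    ∃ V : (ℕ → RatFunc ℚ) → RatFunc ℚ,
      (∀ w, (∀ i j, 1 ≤ i → i ≤ j → j ≤ n → ∑ k ∈ Finset.Icc i j, w k ≠ 0) →
        HasValueAt w f (V w)) ∧
      (∀ w w', (∀ k, 1 ≤ k → k ≤ n → w k = w' k) → V w = V w') ∧
      ∀ a : ℕ → ℚ, ∃ c : ℚ, V (fun k => RatFunc.C (a k)) = RatFunc.C c := by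
  obtain ⟨P, e, hP, rfl⟩ := hf
  refine ⟨fun w => ratEval w P / ∏ i ∈ Finset.Icc 1 n, ∏ j ∈ Finset.Icc i n,
    (∑ k ∈ Finset.Icc i j, w k) ^ e i j, fun w hw => ?_, fun w w' h => ?_, fun a => ?_⟩
  · refine (HasValueAt.of_poly w P).div (HasValueAt.prod _ fun i _ => HasValueAt.prod _ fun j _ =>
      (HasValueAt.usum w i j).pow _) ?_
    refine prod_ne_zero_iff.2 fun i hi => prod_ne_zero_iff.2 fun j hj => pow_ne_zero _ ?_
    rw [mem_Icc] at hi hj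
    exact hw i j hi.1 hj.1 hj.2
  · refine congrArg₂ (· / ·) ?_ ?_
    · exact eval₂Hom_congr' rfl (fun k hk _ => h k (hP k hk).1 (hP k hk).2) rfl
    · refine prod_congr rfl fun i hi => prod_congr rfl fun j hj => ?_
      rw [mem_Icc] at hi hj
      congr 1
      refine sum_congr rfl fun k hk => ?_
      rw [mem_Icc] at hk
      exact h k (hi.1.trans hk.1) (hk.2.trans hj.2)
  · refine ⟨eval a P / ∏ i ∈ Finset.Icc 1 n, ∏ j ∈ Finset.Icc i n,
      (∑ k ∈ Finset.Icc i j, a k) ^ e i j, ?_⟩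
    have : ratEval (fun k => RatFunc.C (a k)) P = RatFunc.C (eval a P) :=
      (eval₂_comp_left RatFunc.C (RingHom.id ℚ) a P).symm
    simp only [this, map_div₀, map_prod, map_pow, map_sum]

theorem sum_natCast_mul_ne_zero (c : ℕ → ℕ) {i j : ℕ} (hij : i ≤ j)
    (hc : ∀ k, i ≤ k → k ≤ j → 0 < c k) (y : RatFunc ℚ) (hy : y ≠ 0) :
    ∑ k ∈ Finset.Icc i j, (c k : RatFunc ℚ) * y ≠ 0 := by
  rw [← Finset.sum_mul, ← Nat.cast_sum]
  refine mul_ne_zero (Nat.cast_ne_zero.2 ?_) hy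
  refine (Finset.sum_pos (fun k hk => ?_) ⟨i, by simp [hij]⟩).ne'
  rw [mem_Icc] at hk
  exact hc k hk.1 hk.2

theorem sum_perm_symm_apply_zero {M : Type*} [CommSemiring M] (m : ℕ) (h : Fin (m + 1) → M) :
    ∑ σ : Equiv.Perm (Fin (m + 1)), h (σ.symm 0) = (m.factorial : M) * ∑ i, h i := by
  rw [← Equiv.sum_comp (Equiv.inv (Equiv.Perm (Fin (m + 1)))),
    ← Equiv.sum_comp Equiv.Perm.decomposeFin.symm, Fintype.sum_prod_type, Finset.mul_sum]
  refine sum_congr rfl fun i _ => ?_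
  have : ∀ e : Equiv.Perm (Fin m),
      (Equiv.inv (Equiv.Perm (Fin (m + 1))) (Equiv.Perm.decomposeFin.symm (i, e))).symm 0 = i :=
    fun e => Equiv.Perm.decomposeFin_symm_apply_zero i e
  simp only [this, sum_const, card_univ, Fintype.card_perm, Fintype.card_fin, nsmul_eq_mul]

theorem permExt_eq_one_iff {m : ℕ} (σ : Equiv.Perm (Fin (m + 1))) {k : ℕ} (hk : 1 ≤ k)
    (hkm : k ≤ m + 1) : permExt (m + 1) σ k = 1 ↔ k = (σ.symm 0 : Fin (m + 1)) + 1 := by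
  rw [permExt, dif_pos ⟨hk, hkm⟩, Nat.add_eq_right, Fin.val_eq_zero_iff,
    ← Equiv.eq_symm_apply, Fin.ext_iff]
  simp only
  omega

theorem rfDeriv_C_mul_X_pow (c : ℚ) (m : ℕ) :
    rfDeriv (RatFunc.C c * RatFunc.X ^ m) =
      (m : RatFunc ℚ) * RatFunc.C c * RatFunc.X ^ (m - 1) := by
  have : (RatFunc.C c * RatFunc.X ^ m : RatFunc ℚ) =
      algebraMap (Polynomial ℚ) (RatFunc ℚ) (Polynomial.C c * Polynomial.X ^ m) := by
    simp
  rw [this, rfDeriv, RatFunc.num_algebraMap, RatFunc.denom_algebraMap]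
  simp [Polynomial.derivative_X_pow]
  ring

/-- for `f ∈ Mould m` and `g ∈ Mould n`, both vegetal, with nice
poles and homogeneous of weights `-m` and `-n`, one has in `ℚ(x)`:
`(f ∘ g)(x⁻¹,…,x⁻¹) = (d/dx f(x⁻¹,…,x⁻¹)) · g(x⁻¹,…,x⁻¹)`. -/
theorem forgetful_preLie (m n : ℕ) (hm : 1 ≤ m) (hn : 1 ≤ n)
    (f g : K) (hf : f ∈ Mould m) (hg : g ∈ Mould n)
    (hfv : IsVegetal m f) (hgv : IsVegetal n g)
    (hfp : HasNicePoles m f) (hgp : HasNicePoles n g)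
    (hfh : IsHomogeneousOfWeight m (-(m : ℤ)) f)
    (hgh : IsHomogeneousOfWeight n (-(n : ℤ)) g) :
    evalx (preLieComp m n f g) = rfDeriv (evalx f) * evalx g := by
  obtain ⟨V, hV, hVcongr, hVconst⟩ := hfp.exists_value
  obtain ⟨W, hW, -, -⟩ := hgp.exists_value
  have hX : (RatFunc.X : RatFunc ℚ) ≠ 0 := RatFunc.X_ne_zero
  have hXi : (RatFunc.X : RatFunc ℚ)⁻¹ ≠ 0 := inv_ne_zero hX
  set ξ : ℕ → RatFunc ℚ := fun _ => RatFunc.X⁻¹ with hξ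
  have hξne : ∀ i j, i ≤ j → ∑ k ∈ Finset.Icc i j, ξ k ≠ 0 := fun i j hij => by
    simpa only [Nat.cast_one, one_mul] using
      sum_natCast_mul_ne_zero (fun _ => 1) hij (by simp) _ hXi
  have hfξ := hV ξ fun i j _ hij _ => hξne i j hij
  have hgξ := hW ξ fun i j _ hij _ => hξne i j hij
  let b : ℕ → ℕ → RatFunc ℚ := fun i k => ((if k = i then n else 1 : ℕ) : RatFunc ℚ) * RatFunc.X⁻¹
  have hb : ∀ i, HasValueAt (b i) f (V (b i)) := fun i =>
    hV _ fun i' j _ hij _ => sum_natCast_mul_ne_zero _ hij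
      (fun k _ _ => by split_ifs <;> omega) _ hXi
  have value_comp : HasValueAt ξ (preLieComp m n f g)
      (∑ i ∈ Finset.Icc 1 m, (n : RatFunc ℚ) * RatFunc.X⁻¹ * V (b i) * W ξ) := by
    refine HasValueAt.sum _ fun i hi => ?_
    have husum : HasValueAt ξ (usum i (i + n - 1)) ((n : RatFunc ℚ) * RatFunc.X⁻¹) := by
      have := HasValueAt.usum ξ i (i + n - 1)
      rwa [hξ, Finset.sum_const, Nat.card_Icc, nsmul_eq_mul,
        show i + n - 1 + 1 - i = n by omega] at this
    refine (husum.mul (HasValueAt.msub (fun k => ?_) (hb i))).mul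
      (HasValueAt.msub (fun k => HasValueAt.of_u ξ _) hgξ)
    unfold compSubF
    rcases lt_trichotomy k i with h | rfl | h
    · simpa [b, h, h.ne] using HasValueAt.of_u ξ k
    · simpa [b] using husum
    · simpa [b, h.not_gt, h.ne'] using HasValueAt.of_u ξ (k + n - 1)
  have sum_V : (n : RatFunc ℚ) * ∑ i ∈ Finset.Icc 1 m, V (b i) = m * V ξ := by
    obtain ⟨m, rfl⟩ : ∃ m', m = m' + 1 := ⟨m - 1, by omega⟩
    let w : ℕ → RatFunc ℚ := fun k =>
      if k = 0 then RatFunc.X⁻¹ else ((if k = 1 then n else 1 : ℕ) : RatFunc ℚ)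
    have hperm : ∀ (σ : Equiv.Perm (Fin (m + 1))) (k : ℕ), 1 ≤ k → k ≤ m + 1 →
        w 0 * w (permExt (m + 1) σ k) = b ((σ.symm 0 : Fin (m + 1)) + 1) k := by
      intro σ k hk hkm
      have h0 : permExt (m + 1) σ k ≠ 0 := by
        rw [permExt, dif_pos ⟨hk, hkm⟩]
        omega
      simp only [w, b, permExt_eq_one_iff σ hk hkm, if_neg h0, if_true]
      exact mul_comm _ _
    have hσ : ∀ σ : Equiv.Perm (Fin (m + 1)),
        HasValueAt w (msub (fun k => u 0 * u (permExt (m + 1) σ k)) f)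
          (V (b ((σ.symm 0 : Fin (m + 1)) + 1))) := by
      intro σ
      refine HasValueAt.msub
        (fun k => (HasValueAt.of_u w 0).mul (HasValueAt.of_u w (permExt (m + 1) σ k))) ?_
      rw [← hVcongr _ _ (hperm σ)]
      refine hV _ fun i j hi hij hj => ?_
      rw [Finset.sum_congr rfl fun k hk => hperm σ k (hi.trans (mem_Icc.1 hk).1)
        ((mem_Icc.1 hk).2.trans hj)]
      exact sum_natCast_mul_ne_zero _ hij (fun k _ _ => by split_ifs <;> omega) _ hXi
    have hprod : ∏ k ∈ Finset.Icc 1 (m + 1), w k = n := by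
      rw [Finset.prod_eq_single_of_mem 1 (by simp)]
      · simp [w]
      · intro k hk hk1
        have : k ≠ 0 := by
          rw [mem_Icc] at hk
          omega
        simp [w, hk1, this]
    have hl := (HasValueAt.prod (Finset.Icc 1 (m + 1)) fun k _ => HasValueAt.of_u w k).mul
      (HasValueAt.sum Finset.univ fun σ _ => hσ σ)
    rw [hfv, hprod, sum_perm_symm_apply_zero m fun i => V (b (i + 1))] at hl
    have hr := (HasValueAt.natCast w (m + 1).factorial).mul
      (HasValueAt.msub (v := fun _ => u 0) (a := ξ)
        (fun _ => by simpa [w] using HasValueAt.of_u w 0) hfξ)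
    have key := hl.unique hr
    have hfac : (m.factorial : RatFunc ℚ) ≠ 0 := Nat.cast_ne_zero.2 m.factorial_ne_zero
    have hsum : ∑ i ∈ Finset.Icc 1 (m + 1), V (b i) = ∑ i : Fin (m + 1), V (b (i + 1)) := by
      rw [Fin.sum_univ_eq_sum_range (fun i => V (b (i + 1))), Finset.range_eq_Ico,
        Finset.sum_Ico_add' (fun i => V (b i)) 0 (m + 1) 1]
      rfl
    rw [hsum]
    refine mul_left_cancel₀ hfac ?_
    rw [Nat.factorial_succ, Nat.cast_mul] at key
    linear_combination key
  obtain ⟨c, hc⟩ : ∃ c : ℚ, V ξ = RatFunc.C c * RatFunc.X ^ m := by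
    obtain ⟨c, hc⟩ := hVconst fun _ => 1
    refine ⟨c, ?_⟩
    let w : ℕ → RatFunc ℚ := fun k => if k = 0 then RatFunc.X⁻¹ else 1
    let a : ℕ → RatFunc ℚ := fun k => if 1 ≤ k ∧ k ≤ m then w 0 * w k else w k
    have haξ : ∀ k, 1 ≤ k → k ≤ m → a k = ξ k := fun k hk hkm => by
      simp [a, w, hk, hkm, hξ, Nat.one_le_iff_ne_zero.1 hk]
    have hw1 : ∀ k, 1 ≤ k → k ≤ m → w k = RatFunc.C 1 := fun k hk _ => by
      simp [w, Nat.one_le_iff_ne_zero.1 hk]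
    have hl : HasValueAt w (msub (fun k => if 1 ≤ k ∧ k ≤ m then u 0 * u k else u k) f) (V ξ) := by
      refine HasValueAt.msub (a := a) (fun k => ?_) ?_
      · dsimp only [a]
        split_ifs
        · exact (HasValueAt.of_u w 0).mul (HasValueAt.of_u w k)
        · exact HasValueAt.of_u w k
      · rw [← hVcongr _ _ haξ]
        refine hV _ fun i j hi hij hj => ?_
        rw [Finset.sum_congr rfl fun k hk => haξ k (hi.trans (mem_Icc.1 hk).1)
          ((mem_Icc.1 hk).2.trans hj)]
        exact hξne i j hij
    have hfw : HasValueAt w f (RatFunc.C c) := by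
      rw [← hc, ← hVcongr _ _ hw1]
      refine hV _ fun i j hi hij hj => ?_
      rw [Finset.sum_congr rfl fun k hk => hw1 k (hi.trans (mem_Icc.1 hk).1)
        ((mem_Icc.1 hk).2.trans hj)]
      simpa using sum_natCast_mul_ne_zero (fun _ => 1) hij (by simp) 1 one_ne_zero
    have hw0 : w 0 = RatFunc.X⁻¹ := if_pos rfl
    have hr := (((HasValueAt.of_u w 0).pow m).inv
      (by rw [hw0]; exact pow_ne_zero _ hXi)).mul hfw
    rw [hfh, zpow_neg, zpow_natCast] at hl
    rw [hl.unique hr, hw0, inv_pow, inv_inv, mul_comm]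
  rw [value_comp.evalx_eq, hfξ.evalx_eq, hgξ.evalx_eq, hc, rfDeriv_C_mul_X_pow]
  rw [hc] at sum_V
  obtain ⟨m, rfl⟩ : ∃ m', m = m' + 1 := ⟨m - 1, by omega⟩
  rw [← Finset.sum_mul, ← Finset.mul_sum, Nat.add_sub_cancel]
  field_simp
  rw [sum_V]
  ring

end MouldOperad
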